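/- For every k ≥ 30 with k ≡ 6 (mod 24), there exists an almost resolvable k-cycle system of order 2k+1. -/

import Mathlib

/-- The set of edges of the closed walk `c 0, c 1, …, c (k-1), c 0`.
When `c` is injective, this is a cycle of length `k`. -/
def cycleEdgeSet {V : Type*} {k : ℕ} (c : ZMod k → V) : Set (Sym2 V) :=
  {e | ∃ i : ZMod k, e = s(c i, c (i + 1))}

/-- `HasARCS k v` asserts the existence of an almost resolvable `k`-cycle system of
order `v`: a collection of `k`-cycles whose edge sets partition the edge set of the
complete graph on `v` vertices, partitioned into `(v-1)/2` almost parallel classes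
(each consisting of `(v-1)/k` pairwise vertex-disjoint `k`-cycles) together with one
half-parallel class (consisting of `(v-1)/(2k)` pairwise vertex-disjoint `k`-cycles). -/
def HasARCS (k v : ℕ) : Prop :=
  ∃ (apc : Fin ((v - 1) / 2) → Fin ((v - 1) / k) → ZMod k → Fin v)
    (hpc : Fin ((v - 1) / (2 * k)) → ZMod k → Fin v),
    (∀ i j, Function.Injective (apc i j)) ∧
    (∀ j, Function.Injective (hpc j)) ∧
    (∀ i, ∀ j₁ j₂, j₁ ≠ j₂ →
      Disjoint (Set.range (apc i j₁)) (Set.range (apc i j₂))) ∧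
    (∀ j₁ j₂, j₁ ≠ j₂ → Disjoint (Set.range (hpc j₁)) (Set.range (hpc j₂))) ∧
    (∀ e : Sym2 (Fin v), ¬ e.IsDiag →
      ∃! p : (Fin ((v - 1) / 2) × Fin ((v - 1) / k)) ⊕ Fin ((v - 1) / (2 * k)),
        e ∈ Sum.elim (fun q => cycleEdgeSet (apc q.1 q.2))
              (fun j => cycleEdgeSet (hpc j)) p)

/-- A zigzag path: `(l₁, a), (l₂, b), (l₁, a+1), (l₂, b-1), …`. -/
def zz (l₁ : Fin 4) (a : ℕ) (l₂ : Fin 4) (b s : ℕ) : Option (Fin 4 × ℕ) :=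
  if s % 2 = 0 then some (l₁, a + s / 2) else some (l₂, b - s / 2)

/-- Cycle number 0 of base class 0. -/
def cyc00 (q t : ℕ) : Option (Fin 4 × ℕ) :=
  if t < 4*q-2 then zz 2 (2*q+3) 1 (2*q-1) (t - (0))
  else if t = 4*q-2 then some (2, 0)
  else if t = 4*q-1 then some (1, 4*q+2)
  else if t = 4*q then some (1, 2*q+1)
  else if t = 4*q+1 then some (2, 2*q+1)
  else if t = 4*q+2 then some (3, 2*q+2)
  else if t = 4*q+3 then some (3, 4*q+2)
  else if t < 8*q+2 then zz 2 (1) 3 (4*q+1) (t - (4*q+4))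
  else if t = 8*q+2 then some (2, 2*q)
  else if t = 8*q+3 then some (0, 0)
  else if t = 8*q+4 then some (1, 0)
  else if t = 8*q+5 then some (1, 2*q)
  else some (2, 2*q+3)

theorem cyc00_pts (q : ℕ) (hq : 2 ≤ q) :
    cyc00 q (0) = some (2, 2*q+3) ∧
    cyc00 q (4*q-3) = some (1, 1) ∧
    cyc00 q (4*q-2) = some (2, 0) ∧
    cyc00 q (4*q-1) = some (1, 4*q+2) ∧
    cyc00 q (4*q) = some (1, 2*q+1) ∧
    cyc00 q (4*q+1) = some (2, 2*q+1) ∧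
    cyc00 q (4*q+2) = some (3, 2*q+2) ∧
    cyc00 q (4*q+3) = some (3, 4*q+2) ∧
    cyc00 q (4*q+4) = some (2, 1) ∧
    cyc00 q (8*q+1) = some (3, 2*q+3) ∧
    cyc00 q (8*q+2) = some (2, 2*q) ∧
    cyc00 q (8*q+3) = some (0, 0) ∧
    cyc00 q (8*q+4) = some (1, 0) ∧
    cyc00 q (8*q+5) = some (1, 2*q) ∧
    cyc00 q (8*q+6) = some (2, 2*q+3) := by
  refine ⟨?_, ?_, ?_, ?_, ?_, ?_, ?_, ?_, ?_, ?_, ?_, ?_, ?_, ?_, ?_⟩ <;> unfold cyc00 zz <;>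
    repeat first
      | exact congrArg (fun z => some (_, z)) (by omega)
      | rfl
      | refine (if_pos (by omega)).trans ?_
      | refine (if_neg (by omega)).trans ?_

theorem cyc00_zig (q : ℕ) (hq : 2 ≤ q) :
    (∀ s, s < 4*q-2 → cyc00 q (0 + s) = zz 2 (2*q+3) 1 (2*q-1) s) ∧
    (∀ s, s < 4*q-2 → cyc00 q (4*q+4 + s) = zz 2 (1) 3 (4*q+1) s) := by
  refine ⟨?_, ?_⟩ <;> intro s hs <;> unfold cyc00 <;>
    repeat first
      | exact congrArg (zz _ _ _ _) (by omega)
      | refine (if_pos (by omega)).trans ?_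
      | refine (if_neg (by omega)).trans ?_

/-- Cycle number 1 of base class 0. -/
def cyc01 (q t : ℕ) : Option (Fin 4 × ℕ) :=
  if t < 2*q-2 then zz 3 (1) 3 (2*q) (t - (0))
  else if t = 2*q-2 then some (0, 3*q+1)
  else if t = 2*q-1 then some (3, q+1)
  else if t = 2*q then some (3, q)
  else if t = 2*q+1 then none
  else if t < 4*q then zz 0 (3*q+3) 0 (3*q) (t - (2*q+2))
  else if t = 4*q then some (3, 0)
  else if t = 4*q+1 then some (1, 2*q+2)
  else if t = 4*q+2 then some (0, 2*q)
  else if t < 8*q+1 then zz 1 (2*q+3) 0 (2*q-1) (t - (4*q+3))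
  else if t = 8*q+1 then some (3, 2*q+1)
  else if t = 8*q+2 then some (2, 2*q+2)
  else if t = 8*q+3 then some (0, 4*q+2)
  else if t = 8*q+4 then some (0, 2*q+1)
  else if t = 8*q+5 then some (2, 4*q+2)
  else some (3, 1)

theorem cyc01_pts (q : ℕ) (hq : 2 ≤ q) :
    cyc01 q (0) = some (3, 1) ∧
    cyc01 q (2*q-3) = some (3, q+2) ∧
    cyc01 q (2*q-2) = some (0, 3*q+1) ∧
    cyc01 q (2*q-1) = some (3, q+1) ∧
    cyc01 q (2*q) = some (3, q) ∧
    cyc01 q (2*q+1) = none ∧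
    cyc01 q (2*q+2) = some (0, 3*q+3) ∧
    cyc01 q (4*q-1) = some (0, 2*q+2) ∧
    cyc01 q (4*q) = some (3, 0) ∧
    cyc01 q (4*q+1) = some (1, 2*q+2) ∧
    cyc01 q (4*q+2) = some (0, 2*q) ∧
    cyc01 q (4*q+3) = some (1, 2*q+3) ∧
    cyc01 q (8*q) = some (0, 1) ∧
    cyc01 q (8*q+1) = some (3, 2*q+1) ∧
    cyc01 q (8*q+2) = some (2, 2*q+2) ∧
    cyc01 q (8*q+3) = some (0, 4*q+2) ∧
    cyc01 q (8*q+4) = some (0, 2*q+1) ∧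
    cyc01 q (8*q+5) = some (2, 4*q+2) ∧
    cyc01 q (8*q+6) = some (3, 1) := by
  refine ⟨?_, ?_, ?_, ?_, ?_, ?_, ?_, ?_, ?_, ?_, ?_, ?_, ?_, ?_, ?_, ?_, ?_, ?_, ?_⟩ <;> unfold cyc01 zz <;>
    repeat first
      | exact congrArg (fun z => some (_, z)) (by omega)
      | rfl
      | refine (if_pos (by omega)).trans ?_
      | refine (if_neg (by omega)).trans ?_

theorem cyc01_zig (q : ℕ) (hq : 2 ≤ q) :
    (∀ s, s < 2*q-2 → cyc01 q (0 + s) = zz 3 (1) 3 (2*q) s) ∧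
    (∀ s, s < 2*q-2 → cyc01 q (2*q+2 + s) = zz 0 (3*q+3) 0 (3*q) s) ∧
    (∀ s, s < 4*q-2 → cyc01 q (4*q+3 + s) = zz 1 (2*q+3) 0 (2*q-1) s) := by
  refine ⟨?_, ?_, ?_⟩ <;> intro s hs <;> unfold cyc01 <;>
    repeat first
      | exact congrArg (zz _ _ _ _) (by omega)
      | refine (if_pos (by omega)).trans ?_
      | refine (if_neg (by omega)).trans ?_

/-- Cycle number 0 of base class 1. -/
def cyc10 (q t : ℕ) : Option (Fin 4 × ℕ) :=
  if t < 2*q-2 then zz 1 (q+2) 1 (q-1) (t - (0))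
  else if t = 2*q-2 then some (2, 4*q+2)
  else if t = 2*q-1 then some (2, 2*q+2)
  else if t = 2*q then some (0, 4*q+1)
  else if t < 6*q-1 then zz 2 (2*q+3) 0 (4*q) (t - (2*q+1))
  else if t = 6*q-1 then some (0, 2*q)
  else if t = 6*q then some (0, 0)
  else if t = 6*q+1 then some (0, 4*q+2)
  else if t = 6*q+2 then some (1, 0)
  else if t = 6*q+3 then some (1, 4*q+2)
  else if t < 8*q+2 then zz 2 (1) 2 (2*q) (t - (6*q+4))
  else if t = 8*q+2 then some (2, q)
  else if t = 8*q+3 then some (2, q+1)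
  else if t = 8*q+4 then none
  else if t = 8*q+5 then some (1, q)
  else some (1, q+2)

theorem cyc10_pts (q : ℕ) (hq : 2 ≤ q) :
    cyc10 q (0) = some (1, q+2) ∧
    cyc10 q (2*q-3) = some (1, 1) ∧
    cyc10 q (2*q-2) = some (2, 4*q+2) ∧
    cyc10 q (2*q-1) = some (2, 2*q+2) ∧
    cyc10 q (2*q) = some (0, 4*q+1) ∧
    cyc10 q (2*q+1) = some (2, 2*q+3) ∧
    cyc10 q (6*q-2) = some (0, 2*q+2) ∧
    cyc10 q (6*q-1) = some (0, 2*q) ∧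
    cyc10 q (6*q) = some (0, 0) ∧
    cyc10 q (6*q+1) = some (0, 4*q+2) ∧
    cyc10 q (6*q+2) = some (1, 0) ∧
    cyc10 q (6*q+3) = some (1, 4*q+2) ∧
    cyc10 q (6*q+4) = some (2, 1) ∧
    cyc10 q (8*q+1) = some (2, q+2) ∧
    cyc10 q (8*q+2) = some (2, q) ∧
    cyc10 q (8*q+3) = some (2, q+1) ∧
    cyc10 q (8*q+4) = none ∧
    cyc10 q (8*q+5) = some (1, q) ∧
    cyc10 q (8*q+6) = some (1, q+2) := by
  refine ⟨?_, ?_, ?_, ?_, ?_, ?_, ?_, ?_, ?_, ?_, ?_, ?_, ?_, ?_, ?_, ?_, ?_, ?_, ?_⟩ <;> unfold cyc10 zz <;>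
    repeat first
      | exact congrArg (fun z => some (_, z)) (by omega)
      | rfl
      | refine (if_pos (by omega)).trans ?_
      | refine (if_neg (by omega)).trans ?_

theorem cyc10_zig (q : ℕ) (hq : 2 ≤ q) :
    (∀ s, s < 2*q-2 → cyc10 q (0 + s) = zz 1 (q+2) 1 (q-1) s) ∧
    (∀ s, s < 4*q-2 → cyc10 q (2*q+1 + s) = zz 2 (2*q+3) 0 (4*q) s) ∧
    (∀ s, s < 2*q-2 → cyc10 q (6*q+4 + s) = zz 2 (1) 2 (2*q) s) := by
  refine ⟨?_, ?_, ?_⟩ <;> intro s hs <;> unfold cyc10 <;>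
    repeat first
      | exact congrArg (zz _ _ _ _) (by omega)
      | refine (if_pos (by omega)).trans ?_
      | refine (if_neg (by omega)).trans ?_

/-- Cycle number 1 of base class 1. -/
def cyc11 (q t : ℕ) : Option (Fin 4 × ℕ) :=
  if t < 4*q-2 then zz 0 (1) 3 (2*q-1) (t - (0))
  else if t = 4*q-2 then some (1, 2*q+1)
  else if t = 4*q-1 then some (3, 0)
  else if t = 4*q then some (0, 2*q+1)
  else if t = 4*q+1 then some (2, 0)
  else if t = 4*q+2 then some (2, 2*q+1)
  else if t = 4*q+3 then some (3, 2*q+1)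
  else if t = 4*q+4 then some (3, 4*q+2)
  else if t < 8*q+3 then zz 1 (2*q+2) 3 (4*q+1) (t - (4*q+5))
  else if t = 8*q+3 then some (1, 4*q+1)
  else if t = 8*q+4 then some (3, 2*q+2)
  else if t = 8*q+5 then some (3, 2*q)
  else some (0, 1)

theorem cyc11_pts (q : ℕ) (hq : 2 ≤ q) :
    cyc11 q (0) = some (0, 1) ∧
    cyc11 q (4*q-3) = some (3, 1) ∧
    cyc11 q (4*q-2) = some (1, 2*q+1) ∧
    cyc11 q (4*q-1) = some (3, 0) ∧
    cyc11 q (4*q) = some (0, 2*q+1) ∧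
    cyc11 q (4*q+1) = some (2, 0) ∧
    cyc11 q (4*q+2) = some (2, 2*q+1) ∧
    cyc11 q (4*q+3) = some (3, 2*q+1) ∧
    cyc11 q (4*q+4) = some (3, 4*q+2) ∧
    cyc11 q (4*q+5) = some (1, 2*q+2) ∧
    cyc11 q (8*q+2) = some (3, 2*q+3) ∧
    cyc11 q (8*q+3) = some (1, 4*q+1) ∧
    cyc11 q (8*q+4) = some (3, 2*q+2) ∧
    cyc11 q (8*q+5) = some (3, 2*q) ∧
    cyc11 q (8*q+6) = some (0, 1) := by
  refine ⟨?_, ?_, ?_, ?_, ?_, ?_, ?_, ?_, ?_, ?_, ?_, ?_, ?_, ?_, ?_⟩ <;> unfold cyc11 zz <;>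
    repeat first
      | exact congrArg (fun z => some (_, z)) (by omega)
      | rfl
      | refine (if_pos (by omega)).trans ?_
      | refine (if_neg (by omega)).trans ?_

theorem cyc11_zig (q : ℕ) (hq : 2 ≤ q) :
    (∀ s, s < 4*q-2 → cyc11 q (0 + s) = zz 0 (1) 3 (2*q-1) s) ∧
    (∀ s, s < 4*q-2 → cyc11 q (4*q+5 + s) = zz 1 (2*q+2) 3 (4*q+1) s) := by
  refine ⟨?_, ?_⟩ <;> intro s hs <;> unfold cyc11 <;>
    repeat first
      | exact congrArg (zz _ _ _ _) (by omega)
      | refine (if_pos (by omega)).trans ?_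
      | refine (if_neg (by omega)).trans ?_

/-- The four base cycles; the first index is the class. -/
def base (q : ℕ) (F j : Fin 2) : ℕ → Option (Fin 4 × ℕ) :=
  if F = 0 then (if j = 0 then cyc00 q else cyc01 q)
  else (if j = 0 then cyc10 q else cyc11 q)

/-- `u v` are consecutive on some base cycle. -/
def Edge (q : ℕ) (u v : Option (Fin 4 × ℕ)) : Prop :=
  ∃ F j t, t < 8*q+6 ∧ ((base q F j t = u ∧ base q F j (t+1) = v) ∨
    (base q F j t = v ∧ base q F j (t+1) = u))

theorem Edge.symm {q : ℕ} {u v : Option (Fin 4 × ℕ)} (h : Edge q u v) : Edge q v u := by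
  obtain ⟨F, j, t, ht, h⟩ := h
  exact ⟨F, j, t, ht, h.symm⟩

theorem edge_of {q t' : ℕ} {u v : Option (Fin 4 × ℕ)} (F j : Fin 2) (t : ℕ)
    (ht : t < 8*q+6 ∧ t' = t + 1) (hu : base q F j t = u) (hv : base q F j t' = v) :
    Edge q u v := by
  obtain ⟨ht, rfl⟩ := ht
  exact ⟨F, j, t, ht, Or.inl ⟨hu, hv⟩⟩

theorem edge_zz {q L a b : ℕ} {l₁ l₂ : Fin 4} (F j : Fin 2) (t : ℕ)
    (hz : ∀ s, s < L → base q F j (t + s) = zz l₁ a l₂ b s) (s : ℕ) (hs : s + 1 < L)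
    (ht : t + s < 8*q+6) :
    Edge q (some (l₁, a + (s+1)/2)) (some (l₂, b - s/2)) := by
  have h1 := hz s (by omega)
  have h2 := hz (s+1) hs
  refine ⟨F, j, t + s, ht, ?_⟩
  rw [← add_assoc] at h2
  rw [h1, h2]
  unfold zz
  rcases Nat.mod_two_eq_zero_or_one s with h | h
  · left
    rw [if_pos h, if_neg (by omega)]
    have e1 : (s+1)/2 = s/2 := by omega
    rw [e1]
    exact ⟨rfl, rfl⟩
  · right
    rw [if_neg (by omega), if_pos (by omega)]
    exact ⟨rfl, rfl⟩

/-- The difference `d` between levels `l` and `l'` is covered, either by one of the base cycles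
or by the half-parallel class. -/
def Dif (q : ℕ) (l l' : Fin 4) (d : ℕ) : Prop :=
  (∃ p r, Edge q (some (l, p)) (some (l', r)) ∧ (p = r + d ∨ p + (4*q+3) = r + d)) ∨
  (l = 0 ∧ l' = 1 ∧ (d = 1 ∨ d = 2))

/-- The vertex `u` is covered by the base class `F`. -/
def Vert (q : ℕ) (F : Fin 2) (u : Option (Fin 4 × ℕ)) : Prop :=
  ∃ j t, t < 8*q+6 ∧ base q F j t = u

theorem vert_zz0 {q L a b x : ℕ} {l₁ l₂ : Fin 4} (F j : Fin 2) (t : ℕ)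
    (hz : ∀ s, s < L → base q F j (t + s) = zz l₁ a l₂ b s) (s : ℕ) (hs : s < L)
    (ht : t + s < 8*q+6) (hx : s % 2 = 0 ∧ a + s / 2 = x) : Vert q F (some (l₁, x)) := by
  refine ⟨j, t + s, ht, ?_⟩
  rw [hz s hs, zz, if_pos hx.1, hx.2]

theorem vert_zz1 {q L a b x : ℕ} {l₁ l₂ : Fin 4} (F j : Fin 2) (t : ℕ)
    (hz : ∀ s, s < L → base q F j (t + s) = zz l₁ a l₂ b s) (s : ℕ) (hs : s < L)
    (ht : t + s < 8*q+6) (hx : s % 2 = 1 ∧ b - s / 2 = x) : Vert q F (some (l₂, x)) := by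
  refine ⟨j, t + s, ht, ?_⟩
  rw [hz s hs, zz, if_neg (by omega), hx.2]

theorem dif00 (q d : ℕ) (hq : 2 ≤ q) (h0 : 1 ≤ d) (hd : d ≤ 2*q+1) : Dif q 0 0 d := by
  obtain ⟨-, -, -, -, -, -, -, -, -, -, -, -, -, -, -, p01_16, p01_17, -, -⟩ := cyc01_pts q hq
  obtain ⟨-, z01_2, -⟩ := cyc01_zig q hq
  obtain ⟨-, -, -, -, -, -, p10_7, p10_8, p10_9, p10_10, -, -, -, -, -, -, -, -, -⟩ := cyc10_pts q hq
  have hc : d = 1 ∨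
      d = 2 ∨
      (3 ≤ d ∧ d ≤ 2*q-1) ∨
      d = 2*q ∨
      d = 2*q+1 := by omega
  rcases hc with h | h | ⟨h1, h2⟩ | h | h
  · exact Or.inl ⟨_, _, edge_of 1 0 (6*q) (by omega) p10_9 p10_10, by omega⟩
  · exact Or.inl ⟨_, _, edge_of 1 0 (6*q-2) (by omega) p10_7 p10_8, by omega⟩
  · exact Or.inl ⟨_, _, edge_zz 0 1 (2*q+2) z01_2 (d-(3)) (by omega) (by omega), by omega⟩
  · exact Or.inl ⟨_, _, edge_of 1 0 (6*q-1) (by omega) p10_8 p10_9, by omega⟩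
  · exact Or.inl ⟨_, _, edge_of 0 1 (8*q+3) (by omega) p01_16 p01_17, by omega⟩

theorem dif01 (q d : ℕ) (hq : 2 ≤ q) (hd : d < 4*q+3) : Dif q 0 1 d := by
  obtain ⟨-, -, -, -, -, -, -, -, -, -, -, p00_12, p00_13, -, -⟩ := cyc00_pts q hq
  obtain ⟨-, -, -, -, -, -, -, -, -, p01_10, p01_11, p01_12, -, -, -, -, -, -, -⟩ := cyc01_pts q hq
  obtain ⟨-, -, z01_3⟩ := cyc01_zig q hq
  obtain ⟨-, -, -, -, -, -, -, -, -, p10_10, p10_11, -, -, -, -, -, -, -, -⟩ := cyc10_pts q hq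
  have hc : d = 0 ∨
      d = 1 ∨
      d = 2 ∨
      (3 ≤ d ∧ d ≤ 4*q-1) ∨
      d = 4*q ∨
      d = 4*q+1 ∨
      d = 4*q+2 := by omega
  rcases hc with h | h | h | ⟨h1, h2⟩ | h | h | h
  · exact Or.inl ⟨_, _, edge_of 0 0 (8*q+3) (by omega) p00_12 p00_13, by omega⟩
  · exact Or.inr ⟨rfl, rfl, by omega⟩
  · exact Or.inr ⟨rfl, rfl, by omega⟩
  · exact Or.inl ⟨_, _, (edge_zz 0 1 (4*q+3) z01_3 (4*q-1-d) (by omega) (by omega)).symm, by omega⟩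
  · exact Or.inl ⟨_, _, edge_of 0 1 (4*q+2) (by omega) p01_11 p01_12, by omega⟩
  · exact Or.inl ⟨_, _, (edge_of 0 1 (4*q+1) (by omega) p01_10 p01_11).symm, by omega⟩
  · exact Or.inl ⟨_, _, edge_of 1 0 (6*q+1) (by omega) p10_10 p10_11, by omega⟩

theorem dif02 (q d : ℕ) (hq : 2 ≤ q) (hd : d < 4*q+3) : Dif q 0 2 d := by
  obtain ⟨-, -, -, -, -, -, -, -, -, -, p00_11, p00_12, -, -, -⟩ := cyc00_pts q hq
  obtain ⟨-, -, -, -, -, -, -, -, -, -, -, -, -, -, p01_15, p01_16, p01_17, p01_18, -⟩ := cyc01_pts q hq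
  obtain ⟨-, -, -, p10_4, p10_5, p10_6, -, -, -, -, -, -, -, -, -, -, -, -, -⟩ := cyc10_pts q hq
  obtain ⟨-, z10_2, -⟩ := cyc10_zig q hq
  obtain ⟨-, -, -, -, p11_5, p11_6, -, -, -, -, -, -, -, -, -⟩ := cyc11_pts q hq
  have hc : (0 ≤ d ∧ d ≤ 2*q-3) ∨
      d = 2*q-2 ∨
      d = 2*q-1 ∨
      d = 2*q ∨
      d = 2*q+1 ∨
      d = 2*q+2 ∨
      d = 2*q+3 ∨
      (2*q+4 ≤ d ∧ d ≤ 4*q+2) := by omega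
  rcases hc with ⟨h1, h2⟩ | h | h | h | h | h | h | ⟨h1, h2⟩
  · exact Or.inl ⟨_, _, (edge_zz 1 0 (2*q+1) z10_2 (2*q-3-d) (by omega) (by omega)).symm, by omega⟩
  · exact Or.inl ⟨_, _, edge_of 1 0 (2*q) (by omega) p10_5 p10_6, by omega⟩
  · exact Or.inl ⟨_, _, (edge_of 1 0 (2*q-1) (by omega) p10_4 p10_5).symm, by omega⟩
  · exact Or.inl ⟨_, _, (edge_of 0 1 (8*q+2) (by omega) p01_15 p01_16).symm, by omega⟩
  · exact Or.inl ⟨_, _, edge_of 1 1 (4*q) (by omega) p11_5 p11_6, by omega⟩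
  · exact Or.inl ⟨_, _, edge_of 0 1 (8*q+4) (by omega) p01_17 p01_18, by omega⟩
  · exact Or.inl ⟨_, _, (edge_of 0 0 (8*q+2) (by omega) p00_11 p00_12).symm, by omega⟩
  · exact Or.inl ⟨_, _, (edge_zz 1 0 (2*q+1) z10_2 (6*q-d) (by omega) (by omega)).symm, by omega⟩

theorem dif03 (q d : ℕ) (hq : 2 ≤ q) (hd : d < 4*q+3) : Dif q 0 3 d := by
  obtain ⟨-, p01_2, p01_3, p01_4, -, -, -, p01_8, p01_9, -, -, -, p01_13, p01_14, -, -, -, -, -⟩ := cyc01_pts q hq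
  obtain ⟨-, -, -, p11_4, p11_5, -, -, -, -, -, -, -, -, p11_14, p11_15⟩ := cyc11_pts q hq
  obtain ⟨z11_1, -⟩ := cyc11_zig q hq
  have hc : (0 ≤ d ∧ d ≤ 2*q-2) ∨
      d = 2*q-1 ∨
      d = 2*q ∨
      d = 2*q+1 ∨
      d = 2*q+2 ∨
      d = 2*q+3 ∨
      d = 2*q+4 ∨
      (2*q+5 ≤ d ∧ d ≤ 4*q+2) := by omega
  rcases hc with ⟨h1, h2⟩ | h | h | h | h | h | h | ⟨h1, h2⟩
  · exact Or.inl ⟨_, _, edge_zz 1 1 (0) z11_1 (d+(2*q-2)) (by omega) (by omega), by omega⟩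
  · exact Or.inl ⟨_, _, (edge_of 0 1 (2*q-3) (by omega) p01_2 p01_3).symm, by omega⟩
  · exact Or.inl ⟨_, _, edge_of 0 1 (2*q-2) (by omega) p01_3 p01_4, by omega⟩
  · exact Or.inl ⟨_, _, (edge_of 1 1 (4*q-1) (by omega) p11_4 p11_5).symm, by omega⟩
  · exact Or.inl ⟨_, _, edge_of 0 1 (4*q-1) (by omega) p01_8 p01_9, by omega⟩
  · exact Or.inl ⟨_, _, edge_of 0 1 (8*q) (by omega) p01_13 p01_14, by omega⟩
  · exact Or.inl ⟨_, _, (edge_of 1 1 (8*q+5) (by omega) p11_14 p11_15).symm, by omega⟩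
  · exact Or.inl ⟨_, _, edge_zz 1 1 (0) z11_1 (d-(2*q+5)) (by omega) (by omega), by omega⟩

theorem dif11 (q d : ℕ) (hq : 2 ≤ q) (h0 : 1 ≤ d) (hd : d ≤ 2*q+1) : Dif q 1 1 d := by
  obtain ⟨-, -, -, p00_4, p00_5, -, -, -, -, -, -, -, p00_13, p00_14, -⟩ := cyc00_pts q hq
  obtain ⟨-, -, -, -, -, -, -, -, -, -, p10_11, p10_12, -, -, -, -, -, p10_18, p10_19⟩ := cyc10_pts q hq
  obtain ⟨z10_1, -, -⟩ := cyc10_zig q hq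
  have hc : d = 1 ∨
      d = 2 ∨
      (3 ≤ d ∧ d ≤ 2*q-1) ∨
      d = 2*q ∨
      d = 2*q+1 := by omega
  rcases hc with h | h | ⟨h1, h2⟩ | h | h
  · exact Or.inl ⟨_, _, edge_of 1 0 (6*q+2) (by omega) p10_11 p10_12, by omega⟩
  · exact Or.inl ⟨_, _, (edge_of 1 0 (8*q+5) (by omega) p10_18 p10_19).symm, by omega⟩
  · exact Or.inl ⟨_, _, edge_zz 1 0 (0) z10_1 (d-(3)) (by omega) (by omega), by omega⟩
  · exact Or.inl ⟨_, _, (edge_of 0 0 (8*q+4) (by omega) p00_13 p00_14).symm, by omega⟩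
  · exact Or.inl ⟨_, _, edge_of 0 0 (4*q-1) (by omega) p00_4 p00_5, by omega⟩

theorem dif12 (q d : ℕ) (hq : 2 ≤ q) (hd : d < 4*q+3) : Dif q 1 2 d := by
  obtain ⟨-, p00_2, p00_3, p00_4, p00_5, p00_6, -, -, -, -, -, -, -, p00_14, p00_15⟩ := cyc00_pts q hq
  obtain ⟨z00_1, -⟩ := cyc00_zig q hq
  obtain ⟨-, p10_2, p10_3, -, -, -, -, -, -, -, -, p10_12, p10_13, -, -, -, -, -, -⟩ := cyc10_pts q hq
  have hc : d = 0 ∨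
      d = 1 ∨
      d = 2 ∨
      (3 ≤ d ∧ d ≤ 4*q-1) ∨
      d = 4*q ∨
      d = 4*q+1 ∨
      d = 4*q+2 := by omega
  rcases hc with h | h | h | ⟨h1, h2⟩ | h | h | h
  · exact Or.inl ⟨_, _, edge_of 0 0 (4*q) (by omega) p00_5 p00_6, by omega⟩
  · exact Or.inl ⟨_, _, edge_of 0 0 (4*q-3) (by omega) p00_2 p00_3, by omega⟩
  · exact Or.inl ⟨_, _, edge_of 1 0 (2*q-3) (by omega) p10_2 p10_3, by omega⟩
  · exact Or.inl ⟨_, _, (edge_zz 0 0 (0) z00_1 (4*q-1-d) (by omega) (by omega)).symm, by omega⟩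
  · exact Or.inl ⟨_, _, edge_of 0 0 (8*q+5) (by omega) p00_14 p00_15, by omega⟩
  · exact Or.inl ⟨_, _, edge_of 1 0 (6*q+3) (by omega) p10_12 p10_13, by omega⟩
  · exact Or.inl ⟨_, _, (edge_of 0 0 (4*q-2) (by omega) p00_3 p00_4).symm, by omega⟩

theorem dif13 (q d : ℕ) (hq : 2 ≤ q) (hd : d < 4*q+3) : Dif q 1 3 d := by
  obtain ⟨-, -, -, -, -, -, -, -, p01_9, p01_10, -, -, -, -, -, -, -, -, -⟩ := cyc01_pts q hq
  obtain ⟨-, p11_2, p11_3, p11_4, -, -, -, -, p11_9, p11_10, p11_11, p11_12, p11_13, -, -⟩ := cyc11_pts q hq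
  obtain ⟨-, z11_2⟩ := cyc11_zig q hq
  have hc : (0 ≤ d ∧ d ≤ 2*q-3) ∨
      d = 2*q-2 ∨
      d = 2*q-1 ∨
      d = 2*q ∨
      d = 2*q+1 ∨
      d = 2*q+2 ∨
      d = 2*q+3 ∨
      (2*q+4 ≤ d ∧ d ≤ 4*q+2) := by omega
  rcases hc with ⟨h1, h2⟩ | h | h | h | h | h | h | ⟨h1, h2⟩
  · exact Or.inl ⟨_, _, edge_zz 1 1 (4*q+5) z11_2 (d+(2*q-1)) (by omega) (by omega), by omega⟩
  · exact Or.inl ⟨_, _, (edge_of 1 1 (8*q+2) (by omega) p11_11 p11_12).symm, by omega⟩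
  · exact Or.inl ⟨_, _, edge_of 1 1 (8*q+3) (by omega) p11_12 p11_13, by omega⟩
  · exact Or.inl ⟨_, _, (edge_of 1 1 (4*q-3) (by omega) p11_2 p11_3).symm, by omega⟩
  · exact Or.inl ⟨_, _, edge_of 1 1 (4*q-2) (by omega) p11_3 p11_4, by omega⟩
  · exact Or.inl ⟨_, _, (edge_of 0 1 (4*q) (by omega) p01_9 p01_10).symm, by omega⟩
  · exact Or.inl ⟨_, _, (edge_of 1 1 (4*q+4) (by omega) p11_9 p11_10).symm, by omega⟩
  · exact Or.inl ⟨_, _, edge_zz 1 1 (4*q+5) z11_2 (d-(2*q+4)) (by omega) (by omega), by omega⟩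

theorem dif22 (q d : ℕ) (hq : 2 ≤ q) (h0 : 1 ≤ d) (hd : d ≤ 2*q+1) : Dif q 2 2 d := by
  obtain ⟨-, -, p10_3, p10_4, -, -, -, -, -, -, -, -, -, p10_14, p10_15, p10_16, -, -, -⟩ := cyc10_pts q hq
  obtain ⟨-, -, z10_3⟩ := cyc10_zig q hq
  obtain ⟨-, -, -, -, -, p11_6, p11_7, -, -, -, -, -, -, -, -⟩ := cyc11_pts q hq
  have hc : d = 1 ∨
      d = 2 ∨
      (3 ≤ d ∧ d ≤ 2*q-1) ∨
      d = 2*q ∨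
      d = 2*q+1 := by omega
  rcases hc with h | h | ⟨h1, h2⟩ | h | h
  · exact Or.inl ⟨_, _, (edge_of 1 0 (8*q+2) (by omega) p10_15 p10_16).symm, by omega⟩
  · exact Or.inl ⟨_, _, edge_of 1 0 (8*q+1) (by omega) p10_14 p10_15, by omega⟩
  · exact Or.inl ⟨_, _, (edge_zz 1 0 (6*q+4) z10_3 (2*q-1-d) (by omega) (by omega)).symm, by omega⟩
  · exact Or.inl ⟨_, _, edge_of 1 0 (2*q-2) (by omega) p10_3 p10_4, by omega⟩
  · exact Or.inl ⟨_, _, (edge_of 1 1 (4*q+1) (by omega) p11_6 p11_7).symm, by omega⟩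

theorem dif23 (q d : ℕ) (hq : 2 ≤ q) (hd : d < 4*q+3) : Dif q 2 3 d := by
  obtain ⟨-, -, -, -, -, p00_6, p00_7, p00_8, p00_9, p00_10, p00_11, -, -, -, -⟩ := cyc00_pts q hq
  obtain ⟨-, z00_2⟩ := cyc00_zig q hq
  obtain ⟨-, -, -, -, -, -, -, -, -, -, -, -, -, p01_14, p01_15, -, -, p01_18, p01_19⟩ := cyc01_pts q hq
  obtain ⟨-, -, -, -, -, -, p11_7, p11_8, -, -, -, -, -, -, -⟩ := cyc11_pts q hq
  have hc : d = 0 ∨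
      d = 1 ∨
      d = 2 ∨
      (3 ≤ d ∧ d ≤ 4*q-1) ∨
      d = 4*q ∨
      d = 4*q+1 ∨
      d = 4*q+2 := by omega
  rcases hc with h | h | h | ⟨h1, h2⟩ | h | h | h
  · exact Or.inl ⟨_, _, edge_of 1 1 (4*q+2) (by omega) p11_7 p11_8, by omega⟩
  · exact Or.inl ⟨_, _, (edge_of 0 1 (8*q+1) (by omega) p01_14 p01_15).symm, by omega⟩
  · exact Or.inl ⟨_, _, (edge_of 0 0 (4*q+3) (by omega) p00_8 p00_9).symm, by omega⟩
  · exact Or.inl ⟨_, _, edge_zz 0 0 (4*q+4) z00_2 (d-(3)) (by omega) (by omega), by omega⟩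
  · exact Or.inl ⟨_, _, (edge_of 0 0 (8*q+1) (by omega) p00_10 p00_11).symm, by omega⟩
  · exact Or.inl ⟨_, _, edge_of 0 1 (8*q+5) (by omega) p01_18 p01_19, by omega⟩
  · exact Or.inl ⟨_, _, edge_of 0 0 (4*q+1) (by omega) p00_6 p00_7, by omega⟩

theorem dif33 (q d : ℕ) (hq : 2 ≤ q) (h0 : 1 ≤ d) (hd : d ≤ 2*q+1) : Dif q 3 3 d := by
  obtain ⟨-, -, -, -, -, -, p00_7, p00_8, -, -, -, -, -, -, -⟩ := cyc00_pts q hq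
  obtain ⟨-, -, -, p01_4, p01_5, -, -, -, -, -, -, -, -, -, -, -, -, -, -⟩ := cyc01_pts q hq
  obtain ⟨z01_1, -, -⟩ := cyc01_zig q hq
  obtain ⟨-, -, -, -, -, -, -, p11_8, p11_9, -, -, -, p11_13, p11_14, -⟩ := cyc11_pts q hq
  have hc : d = 1 ∨
      d = 2 ∨
      (3 ≤ d ∧ d ≤ 2*q-1) ∨
      d = 2*q ∨
      d = 2*q+1 := by omega
  rcases hc with h | h | ⟨h1, h2⟩ | h | h
  · exact Or.inl ⟨_, _, edge_of 0 1 (2*q-1) (by omega) p01_4 p01_5, by omega⟩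
  · exact Or.inl ⟨_, _, edge_of 1 1 (8*q+4) (by omega) p11_13 p11_14, by omega⟩
  · exact Or.inl ⟨_, _, (edge_zz 0 1 (0) z01_1 (2*q-1-d) (by omega) (by omega)).symm, by omega⟩
  · exact Or.inl ⟨_, _, (edge_of 0 0 (4*q+2) (by omega) p00_7 p00_8).symm, by omega⟩
  · exact Or.inl ⟨_, _, (edge_of 1 1 (4*q+3) (by omega) p11_8 p11_9).symm, by omega⟩

theorem dif_inf (q : ℕ) (hq : 2 ≤ q) (l : Fin 4) : ∃ p, Edge q none (some (l, p)) := by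
  obtain ⟨-, -, -, -, p01_5, p01_6, p01_7, -, -, -, -, -, -, -, -, -, -, -, -⟩ := cyc01_pts q hq
  obtain ⟨-, -, -, -, -, -, -, -, -, -, -, -, -, -, -, p10_16, p10_17, p10_18, -⟩ := cyc10_pts q hq
  fin_cases l
  · exact ⟨_, edge_of 0 1 (2*q+1) (by omega) p01_6 p01_7⟩
  · exact ⟨_, edge_of 1 0 (8*q+4) (by omega) p10_17 p10_18⟩
  · exact ⟨_, (edge_of 1 0 (8*q+3) (by omega) p10_16 p10_17).symm⟩
  · exact ⟨_, (edge_of 0 1 (2*q) (by omega) p01_5 p01_6).symm⟩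

theorem vert0_inf (q : ℕ) (hq : 2 ≤ q) : Vert q 0 none := by
  obtain ⟨-, -, -, -, -, p01_6, -, -, -, -, -, -, -, -, -, -, -, -, -⟩ := cyc01_pts q hq
  exact ⟨1, 2*q+1, by omega, p01_6⟩

theorem vert0_0 (q x : ℕ) (hq : 2 ≤ q) (hx : x < 4*q+3) (hm : x ≠ 3*q+2) :
    Vert q 0 (some (0, x)) := by
  obtain ⟨-, -, -, -, -, -, -, -, -, -, -, p00_12, -, -, -⟩ := cyc00_pts q hq
  obtain ⟨-, -, p01_3, -, -, -, -, -, -, -, p01_11, -, -, -, -, p01_16, p01_17, -, -⟩ := cyc01_pts q hq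
  obtain ⟨-, z01_2, z01_3⟩ := cyc01_zig q hq
  have hc : x = 0 ∨
      (1 ≤ x ∧ x ≤ 2*q-1) ∨
      x = 2*q ∨
      x = 2*q+1 ∨
      (2*q+2 ≤ x ∧ x ≤ 3*q) ∨
      x = 3*q+1 ∨
      x = 3*q+2 ∨
      (3*q+3 ≤ x ∧ x ≤ 4*q+1) ∨
      x = 4*q+2 := by omega
  rcases hc with h | ⟨h1, h2⟩ | h | h | ⟨h1, h2⟩ | h | h | ⟨h1, h2⟩ | h
  · exact ⟨0, 8*q+3, by omega, h ▸ p00_12⟩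
  · exact vert_zz1 0 1 (4*q+3) z01_3 (2*(2*q-1-x)+1) (by omega) (by omega) (by omega)
  · exact ⟨1, 4*q+2, by omega, h ▸ p01_11⟩
  · exact ⟨1, 8*q+4, by omega, h ▸ p01_17⟩
  · exact vert_zz1 0 1 (2*q+2) z01_2 (2*(3*q-x)+1) (by omega) (by omega) (by omega)
  · exact ⟨1, 2*q-2, by omega, h ▸ p01_3⟩
  · exact absurd h hm
  · exact vert_zz0 0 1 (2*q+2) z01_2 (2*(x-(3*q+3))) (by omega) (by omega) (by omega)
  · exact ⟨1, 8*q+3, by omega, h ▸ p01_16⟩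

theorem vert0_1 (q x : ℕ) (hq : 2 ≤ q) (hx : x < 4*q+3) :
    Vert q 0 (some (1, x)) := by
  obtain ⟨-, -, -, p00_4, p00_5, -, -, -, -, -, -, -, p00_13, p00_14, -⟩ := cyc00_pts q hq
  obtain ⟨z00_1, -⟩ := cyc00_zig q hq
  obtain ⟨-, -, -, -, -, -, -, -, -, p01_10, -, -, -, -, -, -, -, -, -⟩ := cyc01_pts q hq
  obtain ⟨-, -, z01_3⟩ := cyc01_zig q hq
  have hc : x = 0 ∨
      (1 ≤ x ∧ x ≤ 2*q-1) ∨
      x = 2*q ∨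
      x = 2*q+1 ∨
      x = 2*q+2 ∨
      (2*q+3 ≤ x ∧ x ≤ 4*q+1) ∨
      x = 4*q+2 := by omega
  rcases hc with h | ⟨h1, h2⟩ | h | h | h | ⟨h1, h2⟩ | h
  · exact ⟨0, 8*q+4, by omega, h ▸ p00_13⟩
  · exact vert_zz1 0 0 (0) z00_1 (2*(2*q-1-x)+1) (by omega) (by omega) (by omega)
  · exact ⟨0, 8*q+5, by omega, h ▸ p00_14⟩
  · exact ⟨0, 4*q, by omega, h ▸ p00_5⟩
  · exact ⟨1, 4*q+1, by omega, h ▸ p01_10⟩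
  · exact vert_zz0 0 1 (4*q+3) z01_3 (2*(x-(2*q+3))) (by omega) (by omega) (by omega)
  · exact ⟨0, 4*q-1, by omega, h ▸ p00_4⟩

theorem vert0_2 (q x : ℕ) (hq : 2 ≤ q) (hx : x < 4*q+3) :
    Vert q 0 (some (2, x)) := by
  obtain ⟨-, -, p00_3, -, -, p00_6, -, -, -, -, p00_11, -, -, -, -⟩ := cyc00_pts q hq
  obtain ⟨z00_1, z00_2⟩ := cyc00_zig q hq
  obtain ⟨-, -, -, -, -, -, -, -, -, -, -, -, -, -, p01_15, -, -, p01_18, -⟩ := cyc01_pts q hq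
  have hc : x = 0 ∨
      (1 ≤ x ∧ x ≤ 2*q-1) ∨
      x = 2*q ∨
      x = 2*q+1 ∨
      x = 2*q+2 ∨
      (2*q+3 ≤ x ∧ x ≤ 4*q+1) ∨
      x = 4*q+2 := by omega
  rcases hc with h | ⟨h1, h2⟩ | h | h | h | ⟨h1, h2⟩ | h
  · exact ⟨0, 4*q-2, by omega, h ▸ p00_3⟩
  · exact vert_zz0 0 0 (4*q+4) z00_2 (2*(x-(1))) (by omega) (by omega) (by omega)
  · exact ⟨0, 8*q+2, by omega, h ▸ p00_11⟩
  · exact ⟨0, 4*q+1, by omega, h ▸ p00_6⟩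
  · exact ⟨1, 8*q+2, by omega, h ▸ p01_15⟩
  · exact vert_zz0 0 0 (0) z00_1 (2*(x-(2*q+3))) (by omega) (by omega) (by omega)
  · exact ⟨1, 8*q+5, by omega, h ▸ p01_18⟩

theorem vert0_3 (q x : ℕ) (hq : 2 ≤ q) (hx : x < 4*q+3) :
    Vert q 0 (some (3, x)) := by
  obtain ⟨-, -, -, -, -, -, p00_7, p00_8, -, -, -, -, -, -, -⟩ := cyc00_pts q hq
  obtain ⟨-, z00_2⟩ := cyc00_zig q hq
  obtain ⟨-, -, -, p01_4, p01_5, -, -, -, p01_9, -, -, -, -, p01_14, -, -, -, -, -⟩ := cyc01_pts q hq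
  obtain ⟨z01_1, -, -⟩ := cyc01_zig q hq
  have hc : x = 0 ∨
      (1 ≤ x ∧ x ≤ q-1) ∨
      x = q ∨
      x = q+1 ∨
      (q+2 ≤ x ∧ x ≤ 2*q) ∨
      x = 2*q+1 ∨
      x = 2*q+2 ∨
      (2*q+3 ≤ x ∧ x ≤ 4*q+1) ∨
      x = 4*q+2 := by omega
  rcases hc with h | ⟨h1, h2⟩ | h | h | ⟨h1, h2⟩ | h | h | ⟨h1, h2⟩ | h
  · exact ⟨1, 4*q, by omega, h ▸ p01_9⟩
  · exact vert_zz0 0 1 (0) z01_1 (2*(x-(1))) (by omega) (by omega) (by omega)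
  · exact ⟨1, 2*q, by omega, h ▸ p01_5⟩
  · exact ⟨1, 2*q-1, by omega, h ▸ p01_4⟩
  · exact vert_zz1 0 1 (0) z01_1 (2*(2*q-x)+1) (by omega) (by omega) (by omega)
  · exact ⟨1, 8*q+1, by omega, h ▸ p01_14⟩
  · exact ⟨0, 4*q+2, by omega, h ▸ p00_7⟩
  · exact vert_zz1 0 0 (4*q+4) z00_2 (2*(4*q+1-x)+1) (by omega) (by omega) (by omega)
  · exact ⟨0, 4*q+3, by omega, h ▸ p00_8⟩

theorem vert1_inf (q : ℕ) (hq : 2 ≤ q) : Vert q 1 none := by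
  obtain ⟨-, -, -, -, -, -, -, -, -, -, -, -, -, -, -, -, p10_17, -, -⟩ := cyc10_pts q hq
  exact ⟨0, 8*q+4, by omega, p10_17⟩

theorem vert1_0 (q x : ℕ) (hq : 2 ≤ q) (hx : x < 4*q+3) :
    Vert q 1 (some (0, x)) := by
  obtain ⟨-, -, -, -, p10_5, -, -, p10_8, p10_9, p10_10, -, -, -, -, -, -, -, -, -⟩ := cyc10_pts q hq
  obtain ⟨-, z10_2, -⟩ := cyc10_zig q hq
  obtain ⟨-, -, -, -, p11_5, -, -, -, -, -, -, -, -, -, -⟩ := cyc11_pts q hq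
  obtain ⟨z11_1, -⟩ := cyc11_zig q hq
  have hc : x = 0 ∨
      (1 ≤ x ∧ x ≤ 2*q-1) ∨
      x = 2*q ∨
      x = 2*q+1 ∨
      (2*q+2 ≤ x ∧ x ≤ 4*q) ∨
      x = 4*q+1 ∨
      x = 4*q+2 := by omega
  rcases hc with h | ⟨h1, h2⟩ | h | h | ⟨h1, h2⟩ | h | h
  · exact ⟨0, 6*q, by omega, h ▸ p10_9⟩
  · exact vert_zz0 1 1 (0) z11_1 (2*(x-(1))) (by omega) (by omega) (by omega)
  · exact ⟨0, 6*q-1, by omega, h ▸ p10_8⟩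
  · exact ⟨1, 4*q, by omega, h ▸ p11_5⟩
  · exact vert_zz1 1 0 (2*q+1) z10_2 (2*(4*q-x)+1) (by omega) (by omega) (by omega)
  · exact ⟨0, 2*q, by omega, h ▸ p10_5⟩
  · exact ⟨0, 6*q+1, by omega, h ▸ p10_10⟩

theorem vert1_1 (q x : ℕ) (hq : 2 ≤ q) (hx : x < 4*q+3) (hm : x ≠ q+1) :
    Vert q 1 (some (1, x)) := by
  obtain ⟨-, -, -, -, -, -, -, -, -, -, p10_11, p10_12, -, -, -, -, -, p10_18, -⟩ := cyc10_pts q hq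
  obtain ⟨z10_1, -, -⟩ := cyc10_zig q hq
  obtain ⟨-, -, p11_3, -, -, -, -, -, -, -, -, p11_12, -, -, -⟩ := cyc11_pts q hq
  obtain ⟨-, z11_2⟩ := cyc11_zig q hq
  have hc : x = 0 ∨
      (1 ≤ x ∧ x ≤ q-1) ∨
      x = q ∨
      x = q+1 ∨
      (q+2 ≤ x ∧ x ≤ 2*q) ∨
      x = 2*q+1 ∨
      (2*q+2 ≤ x ∧ x ≤ 4*q) ∨
      x = 4*q+1 ∨
      x = 4*q+2 := by omega
  rcases hc with h | ⟨h1, h2⟩ | h | h | ⟨h1, h2⟩ | h | ⟨h1, h2⟩ | h | h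
  · exact ⟨0, 6*q+2, by omega, h ▸ p10_11⟩
  · exact vert_zz1 1 0 (0) z10_1 (2*(q-1-x)+1) (by omega) (by omega) (by omega)
  · exact ⟨0, 8*q+5, by omega, h ▸ p10_18⟩
  · exact absurd h hm
  · exact vert_zz0 1 0 (0) z10_1 (2*(x-(q+2))) (by omega) (by omega) (by omega)
  · exact ⟨1, 4*q-2, by omega, h ▸ p11_3⟩
  · exact vert_zz0 1 1 (4*q+5) z11_2 (2*(x-(2*q+2))) (by omega) (by omega) (by omega)
  · exact ⟨1, 8*q+3, by omega, h ▸ p11_12⟩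
  · exact ⟨0, 6*q+3, by omega, h ▸ p10_12⟩

theorem vert1_2 (q x : ℕ) (hq : 2 ≤ q) (hx : x < 4*q+3) :
    Vert q 1 (some (2, x)) := by
  obtain ⟨-, -, p10_3, p10_4, -, -, -, -, -, -, -, -, -, -, p10_15, p10_16, -, -, -⟩ := cyc10_pts q hq
  obtain ⟨-, z10_2, z10_3⟩ := cyc10_zig q hq
  obtain ⟨-, -, -, -, -, p11_6, p11_7, -, -, -, -, -, -, -, -⟩ := cyc11_pts q hq
  have hc : x = 0 ∨
      (1 ≤ x ∧ x ≤ q-1) ∨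
      x = q ∨
      x = q+1 ∨
      (q+2 ≤ x ∧ x ≤ 2*q) ∨
      x = 2*q+1 ∨
      x = 2*q+2 ∨
      (2*q+3 ≤ x ∧ x ≤ 4*q+1) ∨
      x = 4*q+2 := by omega
  rcases hc with h | ⟨h1, h2⟩ | h | h | ⟨h1, h2⟩ | h | h | ⟨h1, h2⟩ | h
  · exact ⟨1, 4*q+1, by omega, h ▸ p11_6⟩
  · exact vert_zz0 1 0 (6*q+4) z10_3 (2*(x-(1))) (by omega) (by omega) (by omega)
  · exact ⟨0, 8*q+2, by omega, h ▸ p10_15⟩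
  · exact ⟨0, 8*q+3, by omega, h ▸ p10_16⟩
  · exact vert_zz1 1 0 (6*q+4) z10_3 (2*(2*q-x)+1) (by omega) (by omega) (by omega)
  · exact ⟨1, 4*q+2, by omega, h ▸ p11_7⟩
  · exact ⟨0, 2*q-1, by omega, h ▸ p10_4⟩
  · exact vert_zz0 1 0 (2*q+1) z10_2 (2*(x-(2*q+3))) (by omega) (by omega) (by omega)
  · exact ⟨0, 2*q-2, by omega, h ▸ p10_3⟩

theorem vert1_3 (q x : ℕ) (hq : 2 ≤ q) (hx : x < 4*q+3) :
    Vert q 1 (some (3, x)) := by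
  obtain ⟨-, -, -, p11_4, -, -, -, p11_8, p11_9, -, -, -, p11_13, p11_14, -⟩ := cyc11_pts q hq
  obtain ⟨z11_1, z11_2⟩ := cyc11_zig q hq
  have hc : x = 0 ∨
      (1 ≤ x ∧ x ≤ 2*q-1) ∨
      x = 2*q ∨
      x = 2*q+1 ∨
      x = 2*q+2 ∨
      (2*q+3 ≤ x ∧ x ≤ 4*q+1) ∨
      x = 4*q+2 := by omega
  rcases hc with h | ⟨h1, h2⟩ | h | h | h | ⟨h1, h2⟩ | h
  · exact ⟨1, 4*q-1, by omega, h ▸ p11_4⟩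
  · exact vert_zz1 1 1 (0) z11_1 (2*(2*q-1-x)+1) (by omega) (by omega) (by omega)
  · exact ⟨1, 8*q+5, by omega, h ▸ p11_14⟩
  · exact ⟨1, 4*q+3, by omega, h ▸ p11_8⟩
  · exact ⟨1, 8*q+4, by omega, h ▸ p11_13⟩
  · exact vert_zz1 1 1 (4*q+5) z11_2 (2*(4*q+1-x)+1) (by omega) (by omega) (by omega)
  · exact ⟨1, 4*q+4, by omega, h ▸ p11_9⟩

theorem hasARCS_of {k : ℕ} [NeZero k] {V I : Type} [Fintype V] [DecidableEq V] [Fintype I]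
    (hV : Fintype.card V = 2 * k + 1) (hI : Fintype.card I = k)
    (f : I → Fin 2 → ZMod k → V) (h : ZMod k → V) (miss : I → V)
    (hv : ∀ i x, x ≠ miss i → ∃ j t, f i j t = x)
    (hh : Function.Injective h)
    (he : ∀ x y, x ≠ y → (∃ i j t, s(x, y) = s(f i j t, f i j (t + 1))) ∨
      ∃ t, s(x, y) = s(h t, h (t + 1))) : HasARCS k (2 * k + 1) := by
  classical
  have hk : 0 < k := Nat.pos_of_ne_zero (NeZero.ne k)
  have n1 : (2 * k + 1 - 1) / 2 = k := by omega
  have n2 : (2 * k + 1 - 1) / k = 2 := by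
    rw [Nat.add_sub_cancel]; exact Nat.mul_div_cancel _ hk
  have n3 : (2 * k + 1 - 1) / (2 * k) = 1 := by
    rw [Nat.add_sub_cancel]; exact Nat.div_self (by omega)
  -- injectivity on each class
  have hinj : ∀ i, Function.Injective (fun p : Fin 2 × ZMod k => f i p.1 p.2) := by
    intro i
    have hsub : (Finset.univ.erase (miss i)) ⊆
        Finset.univ.image (fun p : Fin 2 × ZMod k => f i p.1 p.2) := by
      intro x hx
      obtain ⟨j, t, hjt⟩ := hv i x (Finset.ne_of_mem_erase hx)
      exact Finset.mem_image.2 ⟨(j, t), Finset.mem_univ _, hjt⟩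
    have hc := Finset.card_le_card hsub
    rw [Finset.card_erase_of_mem (Finset.mem_univ _), Finset.card_univ, hV] at hc
    have hd : (Finset.univ : Finset (Fin 2 × ZMod k)).card = 2 * k := by
      rw [Finset.card_univ, Fintype.card_prod, Fintype.card_fin, ZMod.card]
    have h2 := Finset.card_image_le (s := (Finset.univ : Finset (Fin 2 × ZMod k)))
      (f := fun p : Fin 2 × ZMod k => f i p.1 p.2)
    have h3 : Set.InjOn (fun p : Fin 2 × ZMod k => f i p.1 p.2)
        ((Finset.univ : Finset (Fin 2 × ZMod k)) : Set _) :=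
      Finset.card_image_iff.1 (by omega)
    intro a b hab
    exact h3 (by simp) (by simp) hab
  -- injectivity on edges
  let g : ((I × Fin 2) × ZMod k) ⊕ ZMod k → Sym2 V :=
    Sum.elim (fun p => s(f p.1.1 p.1.2 p.2, f p.1.1 p.1.2 (p.2 + 1))) (fun t => s(h t, h (t + 1)))
  have hsurj : ∀ e : Sym2 V, ¬ e.IsDiag → ∃ p, g p = e := by
    intro e
    induction e using Sym2.ind with
    | _ x y =>
      intro hd
      rcases he x y (by simpa using hd) with ⟨i, j, t, ht⟩ | ⟨t, ht⟩
      · exact ⟨Sum.inl ((i, j), t), ht.symm⟩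
      · exact ⟨Sum.inr t, ht.symm⟩
  have ginj : Function.Injective g := by
    have hsub : (Finset.univ.filter (fun e : Sym2 V => ¬ e.IsDiag)) ⊆ Finset.univ.image g := by
      intro e he'
      obtain ⟨p, hp⟩ := hsurj e (Finset.mem_filter.1 he').2
      exact Finset.mem_image.2 ⟨p, Finset.mem_univ _, hp⟩
    have hc := Finset.card_le_card hsub
    have hcard : (Finset.univ.filter (fun e : Sym2 V => ¬ e.IsDiag)).card = (2 * k + 1).choose 2 := by
      have := Sym2.card_subtype_not_diag (α := V)
      rw [Fintype.card_subtype, hV] at this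
      exact this
    rw [hcard, Nat.choose_two_right] at hc
    have hd : (Finset.univ : Finset (((I × Fin 2) × ZMod k) ⊕ ZMod k)).card = k * 2 * k + k := by
      simp [ZMod.card, hI]
    have h2 := Finset.card_image_le (s := (Finset.univ : Finset (((I × Fin 2) × ZMod k) ⊕ ZMod k)))
      (f := g)
    have h4 : (2 * k + 1) * (2 * k + 1 - 1) / 2 = k * 2 * k + k := by
      rw [Nat.add_sub_cancel]
      apply Nat.div_eq_of_eq_mul_left (by norm_num)
      ring
    have h3 : Set.InjOn g ((Finset.univ : Finset (((I × Fin 2) × ZMod k) ⊕ ZMod k)) : Set _) :=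
      Finset.card_image_iff.1 (by omega)
    intro a b hab
    exact h3 (by simp) (by simp) hab
  -- transfer
  let eV : V ≃ Fin (2 * k + 1) := Fintype.equivFinOfCardEq hV
  let eI : Fin ((2 * k + 1 - 1) / 2) ≃ I := (Fintype.equivFinOfCardEq (hI.trans n1.symm)).symm
  let eJ : Fin ((2 * k + 1 - 1) / k) ≃ Fin 2 := finCongr n2
  have hsub1 : ∀ a b : Fin ((2 * k + 1 - 1) / (2 * k)), a = b := by
    intro a b
    apply Fin.ext
    have := a.2
    have := b.2
    omega
  refine ⟨fun i j t => eV (f (eI i) (eJ j) t), fun _ t => eV (h t), ?_, ?_, ?_, ?_, ?_⟩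
  · intro i j a b hab
    have := hinj (eI i) (a₁ := (eJ j, a)) (a₂ := (eJ j, b)) (eV.injective hab)
    exact (Prod.mk.inj this).2
  · intro j a b hab
    exact hh (eV.injective hab)
  · intro i j₁ j₂ hj
    rw [Set.disjoint_left]
    rintro x ⟨a, rfl⟩ ⟨b, hb⟩
    have := hinj (eI i) (a₁ := (eJ j₂, b)) (a₂ := (eJ j₁, a)) (eV.injective hb)
    exact hj (eJ.injective (Prod.mk.inj this).1).symm
  · intro j₁ j₂ hj
    exact absurd (hsub1 _ _) hj
  · intro e hed
    have key : ∀ x y : V, Sym2.map eV.symm e = s(x, y) ↔ e = s(eV x, eV y) := by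
      intro x y
      constructor
      · intro hxy
        have h1 := congrArg (Sym2.map eV) hxy
        rw [Sym2.map_map] at h1
        simpa using h1
      · rintro rfl
        simp
    obtain ⟨p, hp⟩ := hsurj (Sym2.map eV.symm e) (by
      induction e using Sym2.ind with
      | _ x y =>
        intro hc
        apply hed
        have hc' : eV.symm x = eV.symm y := by simpa using hc
        simpa using hc')
    have uniq : ∀ p', g p' = Sym2.map eV.symm e → p' = p := fun p' h' => ginj (h'.trans hp.symm)
    rcases p with ⟨⟨i, j⟩, t⟩ | t
    · refine ⟨Sum.inl (eI.symm i, eJ.symm j), ⟨t, ?_⟩, ?_⟩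
      · simpa using (key _ _).1 hp.symm
      · rintro (⟨i', j'⟩ | j') ⟨t', ht'⟩
        · have := uniq (Sum.inl ((eI i', eJ j'), t')) ((key _ _).2 ht').symm
          simp only [Sum.inl.injEq, Prod.mk.injEq] at this
          obtain ⟨⟨h1, h2⟩, -⟩ := this
          rw [← h1, ← h2]; simp
        · have := uniq (Sum.inr t') ((key _ _).2 ht').symm
          simp at this
    · refine ⟨Sum.inr ⟨0, by omega⟩, ⟨t, ?_⟩, ?_⟩
      · exact (key _ _).1 hp.symm
      · rintro (⟨i', j'⟩ | j') ⟨t', ht'⟩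
        · have := uniq (Sum.inl ((eI i', eJ j'), t')) ((key _ _).2 ht').symm
          simp at this
        · exact congrArg Sum.inr (hsub1 _ _)


theorem base_wrap (q : ℕ) (hq : 2 ≤ q) (F j : Fin 2) :
    base q F j (8*q+6) = base q F j 0 := by
  have h00 := cyc00_pts q hq
  have h01 := cyc01_pts q hq
  have h10 := cyc10_pts q hq
  have h11 := cyc11_pts q hq
  fin_cases F <;> fin_cases j
  · exact (show cyc00 q (8*q+6) = cyc00 q 0 by simp only [h00])
  · exact (show cyc01 q (8*q+6) = cyc01 q 0 by simp only [h01])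
  · exact (show cyc10 q (8*q+6) = cyc10 q 0 by simp only [h10])
  · exact (show cyc11 q (8*q+6) = cyc11 q 0 by simp only [h11])

theorem dif_all (q : ℕ) (hq : 2 ≤ q) (l l' : Fin 4) (hl : l ≤ l') (d : ℕ) (hd : d < 4*q+3)
    (hp : l = l' → 1 ≤ d ∧ d ≤ 2*q+1) : Dif q l l' d := by
  fin_cases l <;> fin_cases l' <;> first
    | exact absurd hl (by decide)
    | exact dif00 q d hq (hp rfl).1 (hp rfl).2
    | exact dif11 q d hq (hp rfl).1 (hp rfl).2
    | exact dif22 q d hq (hp rfl).1 (hp rfl).2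
    | exact dif33 q d hq (hp rfl).1 (hp rfl).2
    | exact dif01 q d hq hd
    | exact dif02 q d hq hd
    | exact dif03 q d hq hd
    | exact dif12 q d hq hd
    | exact dif13 q d hq hd
    | exact dif23 q d hq hd

/-- The (unshifted) vertex missed by the base class `F`. -/
def missed (q : ℕ) (F : Fin 2) : Fin 4 × ℕ := if F = 0 then (0, 3*q+2) else (1, q+1)

theorem vert_all (q : ℕ) (hq : 2 ≤ q) (F : Fin 2) (l : Fin 4) (x : ℕ) (hx : x < 4*q+3)
    (hm : (l, x) ≠ missed q F) : Vert q F (some (l, x)) := by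
  fin_cases F <;> fin_cases l <;> first
    | exact vert0_0 q x hq hx (fun h => hm (by rw [h]; rfl))
    | exact vert0_1 q x hq hx
    | exact vert0_2 q x hq hx
    | exact vert0_3 q x hq hx
    | exact vert1_0 q x hq hx
    | exact vert1_1 q x hq hx (fun h => hm (by rw [h]; rfl))
    | exact vert1_2 q x hq hx
    | exact vert1_3 q x hq hx

/-- Reduce a base vertex modulo `n` and translate it by `s`. -/
def place (n : ℕ) (s : ZMod n) (u : Option (Fin 4 × ℕ)) : Option (Fin 4 × ZMod n) :=
  u.map (fun p => (p.1, (p.2 : ZMod n) + s))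

/-- The half-parallel class. -/
def halfCycle (n t : ℕ) : Option (Fin 4 × ZMod n) :=
  if t % 2 = 0 then some (0, ((t / 2 : ℕ) : ZMod n)) else some (1, ((t / 2 : ℕ) : ZMod n) - 1)

theorem wrap_val {α : Type} {k : ℕ} [NeZero k] (g : ℕ → α) (hg : g k = g 0) (t : ℕ)
    (ht : t < k) :
    g ((t : ZMod k)).val = g t ∧ g ((t : ZMod k) + 1).val = g (t + 1) := by
  refine ⟨by rw [ZMod.val_natCast_of_lt ht], ?_⟩
  have e : (t : ZMod k) + 1 = ((t + 1 : ℕ) : ZMod k) := by push_cast; rfl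
  rw [e]
  rcases Nat.lt_or_ge (t + 1) k with h | h
  · rw [ZMod.val_natCast_of_lt h]
  · have h' : t + 1 = k := by omega
    rw [h', ZMod.natCast_self, ZMod.val_zero, hg]

theorem arcs_of_q (q : ℕ) (hq : 2 ≤ q) : HasARCS (8*q+6) (2*(8*q+6)+1) := by
  have nz : ((4*q+3 : ℕ) : ZMod (4*q+3)) = 0 := ZMod.natCast_self _
  have hwr : ∀ (s : ZMod (4*q+3)) F j, (fun t => place (4*q+3) s (base q F j t)) (8*q+6) =
      (fun t => place (4*q+3) s (base q F j t)) 0 := by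
    intro s F j
    simp only [base_wrap q hq F j]
  have hhw : halfCycle (4*q+3) (8*q+6) = halfCycle (4*q+3) 0 := by
    unfold halfCycle
    rw [if_pos (by omega), if_pos (by omega), show (8*q+6)/2 = 4*q+3 by omega, nz]
    simp
  -- covering of edges from covering of differences
  have cov : ∀ (l l' : Fin 4) (a b : ZMod (4*q+3)), Dif q l l' (a - b).val →
      (∃ (i : Fin 2 × ZMod (4*q+3)) (j : Fin 2) (t : ZMod (8*q+6)),
        s((some (l, a) : Option (Fin 4 × ZMod (4*q+3))), some (l', b)) =
        s(place (4*q+3) i.2 (base q i.1 j t.val), place (4*q+3) i.2 (base q i.1 j (t+1).val))) ∨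
      ∃ t : ZMod (8*q+6), s((some (l, a) : Option (Fin 4 × ZMod (4*q+3))), some (l', b)) =
        s(halfCycle (4*q+3) t.val, halfCycle (4*q+3) (t+1).val) := by
    intro l l' a b h
    have hab : (((a - b).val : ℕ) : ZMod (4*q+3)) = a - b := ZMod.natCast_zmod_val _
    rcases h with ⟨p, r, ⟨F, j, t, ht, hE⟩, hpr⟩ | ⟨rfl, rfl, hd⟩
    · left
      have hd : (p : ZMod (4*q+3)) = r + (a - b) := by
        rw [← hab]
        rcases hpr with h | h
        · rw [h]; push_cast; rfl
        · have := congrArg (fun z : ℕ => (z : ZMod (4*q+3))) h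
          simp only [Nat.cast_add] at this
          rw [← this]
          have nz' := nz
          push_cast at nz' ⊢
          rw [nz', add_zero]
      refine ⟨(F, a - p), j, (t : ZMod (8*q+6)), ?_⟩
      obtain ⟨w1, w2⟩ := wrap_val (fun t => place (4*q+3) (a - p) (base q F j t)) (hwr (a - p) F j) t ht
      simp only at w1 w2 ⊢
      rw [w1, w2]
      have e1 : place (4*q+3) (a - p) (some (l, p)) = some (l, a) := by
        simp [place]
      have e2 : place (4*q+3) (a - p) (some (l', r)) = some (l', b) := by
        simp only [place, Option.map_some, hd]
        congr 2
        ring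
      rcases hE with ⟨h1, h2⟩ | ⟨h1, h2⟩
      · rw [h1, h2, e1, e2]
      · rw [h1, h2, e1, e2, Sym2.eq_swap]
    · right
      rcases hd with hd | hd <;> rw [hd] at hab
      · have ha := ZMod.val_lt a
        refine ⟨((2 * a.val : ℕ) : ZMod (8*q+6)), ?_⟩
        obtain ⟨w1, w2⟩ := wrap_val _ hhw (2 * a.val) (by omega)
        rw [w1, w2]
        unfold halfCycle
        rw [if_pos (by omega), if_neg (by omega), show 2 * a.val / 2 = a.val by omega,
          show (2 * a.val + 1) / 2 = a.val by omega, ZMod.natCast_zmod_val]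
        have : b = a - 1 := by
          push_cast at hab
          rw [hab]; ring
        rw [this]
      · have hb := ZMod.val_lt (b + 1)
        refine ⟨((2 * (b+1).val + 1 : ℕ) : ZMod (8*q+6)), ?_⟩
        obtain ⟨w1, w2⟩ := wrap_val _ hhw (2 * (b+1).val + 1) (by omega)
        rw [w1, w2]
        unfold halfCycle
        rw [if_neg (by omega), if_pos (by omega),
          show (2 * (b+1).val + 1) / 2 = (b+1).val by omega,
          show (2 * (b+1).val + 1 + 1) / 2 = (b+1).val + 1 by omega, Nat.cast_add,
          ZMod.natCast_zmod_val]
        have : a = b + 2 := by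
          push_cast at hab
          rw [hab]; ring
        rw [this, Sym2.eq_swap]
        congr 3
        · ring
        · push_cast; ring
  have covinf : ∀ (l : Fin 4) (a : ZMod (4*q+3)),
      (∃ (i : Fin 2 × ZMod (4*q+3)) (j : Fin 2) (t : ZMod (8*q+6)),
        s((none : Option (Fin 4 × ZMod (4*q+3))), some (l, a)) =
        s(place (4*q+3) i.2 (base q i.1 j t.val), place (4*q+3) i.2 (base q i.1 j (t+1).val))) := by
    intro l a
    obtain ⟨p, F, j, t, ht, hE⟩ := dif_inf q hq l
    refine ⟨(F, a - p), j, (t : ZMod (8*q+6)), ?_⟩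
    obtain ⟨w1, w2⟩ := wrap_val (fun t => place (4*q+3) (a - p) (base q F j t)) (hwr (a - p) F j) t ht
    simp only at w1 w2 ⊢
    rw [w1, w2]
    have e1 : place (4*q+3) (a - p) (some (l, p)) = some (l, a) := by
      simp [place]
    have e2 : place (4*q+3) (a - p) none = none := rfl
    rcases hE with ⟨h1, h2⟩ | ⟨h1, h2⟩
    · rw [h1, h2, e1, e2]
    · rw [h1, h2, e1, e2, Sym2.eq_swap]
  refine hasARCS_of (V := Option (Fin 4 × ZMod (4*q+3))) (I := Fin 2 × ZMod (4*q+3)) ?_ ?_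
    (fun i j t => place (4*q+3) i.2 (base q i.1 j t.val))
    (fun t => halfCycle (4*q+3) t.val)
    (fun i => place (4*q+3) i.2 (some (missed q i.1))) ?_ ?_ ?_
  · rw [Fintype.card_option, Fintype.card_prod, Fintype.card_fin, ZMod.card]; ring
  · rw [Fintype.card_prod, Fintype.card_fin, ZMod.card]; ring
  · rintro ⟨F, s⟩ x hx
    simp only at hx ⊢
    have fin : ∀ u, Vert q F u → place (4*q+3) s u = x →
        ∃ (j : Fin 2) (t : ZMod (8*q+6)), place (4*q+3) s (base q F j t.val) = x := by
      rintro u ⟨j, t, ht, hu⟩ hux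
      refine ⟨j, (t : ZMod (8*q+6)), ?_⟩
      rw [ZMod.val_natCast_of_lt ht, hu, hux]
    rcases x with _ | ⟨l, a⟩
    · refine fin none ?_ rfl
      fin_cases F
      · exact vert0_inf q hq
      · exact vert1_inf q hq
    · have e : place (4*q+3) s (some (l, (a - s).val)) = some (l, a) := by
        simp [place]
      refine fin (some (l, (a - s).val)) (vert_all q hq F l _ (ZMod.val_lt _) ?_) e
      intro hm
      exact hx (by rw [← hm, e])
  · intro x y hxy
    have hx := ZMod.val_lt x
    have hy := ZMod.val_lt y
    apply ZMod.val_injective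
    simp only [halfCycle] at hxy
    have inj : ∀ a b : ℕ, a < 4*q+3 → b < 4*q+3 → (a : ZMod (4*q+3)) = b → a = b := by
      intro a b ha hb hab
      have := congrArg ZMod.val hab
      rwa [ZMod.val_natCast_of_lt ha, ZMod.val_natCast_of_lt hb] at this
    split_ifs at hxy with h1 h2 h2
    · have := inj _ _ (by omega) (by omega) (Prod.mk.inj (Option.some.inj hxy)).2
      omega
    · exact absurd (Prod.mk.inj (Option.some.inj hxy)).1 (by decide)
    · exact absurd (Prod.mk.inj (Option.some.inj hxy)).1 (by decide)
    · have := inj _ _ (by omega) (by omega) (sub_left_injective (Prod.mk.inj (Option.some.inj hxy)).2)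
      omega
  · intro x y hxy
    rcases x with _ | ⟨l, a⟩ <;> rcases y with _ | ⟨l', b⟩
    · exact absurd rfl hxy
    · exact Or.inl (covinf l' b)
    · rw [Sym2.eq_swap]
      exact Or.inl (covinf l a)
    · rcases lt_trichotomy l l' with h | h | h
      · exact cov l l' a b (dif_all q hq l l' h.le _ (ZMod.val_lt _) (fun h' => absurd h' h.ne))
      · subst h
        have hne : a - b ≠ 0 := fun h0 => hxy (by rw [sub_eq_zero.1 h0])
        have hv : (a - b).val ≠ 0 := fun h0 => hne ((ZMod.val_eq_zero _).1 h0)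
        have hneg : (b - a).val = (4*q+3) - (a - b).val := by
          rw [← neg_sub a b, ZMod.neg_val, if_neg hne]
        rcases Nat.lt_or_ge (2*q+1) (a - b).val with h | h
        · rw [Sym2.eq_swap]
          have := ZMod.val_lt (a - b)
          exact cov l l b a (dif_all q hq l l le_rfl _ (ZMod.val_lt _) (fun _ => by omega))
        · exact cov l l a b (dif_all q hq l l le_rfl _ (ZMod.val_lt _) (fun _ => by omega))
      · rw [Sym2.eq_swap]
        exact cov l' l b a (dif_all q hq l' l h.le _ (ZMod.val_lt _) (fun h' => absurd h' h.ne))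

/-- For every `k ≥ 30` with `k ≡ 6 (mod 24)`, there exists an almost resolvable
`k`-cycle system of order `2k+1`. -/
theorem arcs_mod24_case_6 (k : ℕ) (hk : 30 ≤ k) (hk24 : k % 24 = 6) :
    HasARCS k (2 * k + 1) := by
  obtain ⟨q, hq, rfl⟩ : ∃ q, 2 ≤ q ∧ k = 8*q+6 := ⟨(k - 6) / 8, by omega, by omega⟩
  exact arcs_of_q q hq
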